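/- Let n ≥ 4 be divisible by 6 and let ρ be any n-qubit density matrix. Then for every pair of distinct nontrivial g, h ∈ ℤ₂×ℤ₂, the global fidelity with the cyclic cluster state lower-bounds the triangle-game winning probability: ⟨C_n| ρ |C_n⟩ ≤ P_n^{(Q)}(g,h|ρ). In particular, f_n := ⟨C_n| ρ |C_n⟩ ≤ P_n^{(Q,min)}(ρ) := min over distinct nontrivial g, h of P_n^{(Q)}(g,h|ρ). -/

import Mathlib

open Matrix Complex
open scoped ComplexOrder

noncomputable section

/-- The state space of `n` qubits, as functions on classical bit strings. -/
abbrev QState (n : ℕ) := (Fin n → Fin 2) → ℂ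

/-- Operators on `n` qubits: `2^n × 2^n` complex matrices. -/
abbrev Op (n : ℕ) := Matrix (Fin n → Fin 2) (Fin n → Fin 2) ℂ

/-- The single-qubit Pauli `X` matrix. -/
def Xmat : Matrix (Fin 2) (Fin 2) ℂ := !![0, 1; 1, 0]

/-- The single-qubit Pauli `Z` matrix. -/
def Zmat : Matrix (Fin 2) (Fin 2) ℂ := !![1, 0; 0, -1]

/-- Map a 1-based cyclic site label `j ∈ {1,…,n}` (taken mod `n`) to an index in `Fin n`. -/
def site (n : ℕ) [NeZero n] (j : ℕ) : Fin n :=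
  ⟨(j + (n - 1)) % n, Nat.mod_lt _ (Nat.pos_of_ne_zero (NeZero.ne n))⟩

/-- The operator acting as the single-qubit matrix `M` on qubit `i` and as identity elsewhere. -/
def onSite (n : ℕ) (i : Fin n) (M : Matrix (Fin 2) (Fin 2) ℂ) : Op n :=
  Matrix.of fun s t => (if ∀ k, k ≠ i → s k = t k then 1 else 0) * M (s i) (t i)

/-- Pauli `X` on (1-based, cyclic) site `j`. -/
def PX (n : ℕ) [NeZero n] (j : ℕ) : Op n := onSite n (site n j) Xmat

/-- Pauli `Z` on (1-based, cyclic) site `j`. -/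
def PZ (n : ℕ) [NeZero n] (j : ℕ) : Op n := onSite n (site n j) Zmat

/-- The cyclic cluster stabilizer `K_j = Z_{j-1} X_j Z_{j+1}` (for `1 ≤ j ≤ n`). -/
def Kstab (n : ℕ) [NeZero n] (j : ℕ) : Op n := PZ n (j - 1) * PX n j * PZ n (j + 1)

/-- The symmetry group `ℤ₂ × ℤ₂`. -/
abbrev G2 := ZMod 2 × ZMod 2

/-- The nontrivial element `x = (0,1)` of `ℤ₂ × ℤ₂`. -/
def gx : G2 := (0, 1)

/-- The nontrivial element `y = (1,0)` of `ℤ₂ × ℤ₂`. -/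
def gy : G2 := (1, 0)

/-- The nontrivial element `z = (1,1)` of `ℤ₂ × ℤ₂`. -/
def gz : G2 := (1, 1)

/-- The global symmetry representation `U((a,b)) = ∏_{j odd} X_j^a ∏_{j even} X_j^b`
on `n` qubits (`n` even), written as a product over the `n/2` two-site blocks. -/
def Usym (n : ℕ) [NeZero n] (g : G2) : Op n :=
  ((List.range (n / 2)).map
    (fun p => PX n (2 * p + 1) ^ g.1.val * PX n (2 * p + 2) ^ g.2.val)).prod

/-- Left boundary operator `V^L_p((a,b))`: `Z^b` on qubit `2p-1` and `X^b Z^a` on qubit `2p`. -/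
def VL (n : ℕ) [NeZero n] (p : ℕ) (g : G2) : Op n :=
  PZ n (2 * p - 1) ^ g.2.val * (PX n (2 * p) ^ g.2.val * PZ n (2 * p) ^ g.1.val)

/-- Right boundary operator `V^R_p((a,b))`: `Z^b X^a` on qubit `2p-1` and `Z^a` on qubit `2p`. -/
def VR (n : ℕ) [NeZero n] (p : ℕ) (g : G2) : Op n :=
  (PZ n (2 * p - 1) ^ g.2.val * PX n (2 * p - 1) ^ g.1.val) * PZ n (2 * p) ^ g.1.val

/-- Truncated symmetry `U_{[p,q]}((a,b)) = ∏_{r=p+1}^{q-1} X_{2r-1}^a X_{2r}^b`. -/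
def Ustr (n : ℕ) [NeZero n] (p q : ℕ) (g : G2) : Op n :=
  ((List.range (q - (p + 1))).map
    (fun r => PX n (2 * (p + 1 + r) - 1) ^ g.1.val * PX n (2 * (p + 1 + r)) ^ g.2.val)).prod

/-- The string order parameter `S_{[p,q]}(g) = V^L_p(g) · U_{[p,q]}(g) · V^R_q(g)`. -/
def SOPm (n : ℕ) [NeZero n] (p q : ℕ) (g : G2) : Op n :=
  VL n p g * Ustr n p q g * VR n q g

/-- The twisted string order parameter
`T_{[p,q]}^{(g,h)} = V^R_q(g) · U(h) · V^L_p(g) · U_{[p,q]}(g)`. -/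
def TSOP (n : ℕ) [NeZero n] (p q : ℕ) (g h : G2) : Op n :=
  VR n q g * Usym n h * VL n p g * Ustr n p q g

/-- The triangle-game winning operator
`O_{g,h} = (1/32)(12·1 + 12 U(g) + U(h) + U(gh) − 3T − 3U(g)T)` with `T = T_{[1,n/6+1]}^{(g,h)}`. -/
def Owin (n : ℕ) [NeZero n] (g h : G2) : Op n :=
  (32 : ℂ)⁻¹ • (12 • (1 : Op n) + 12 • Usym n g + Usym n h + Usym n (g + h)
    - 3 • TSOP n 1 (n / 6 + 1) g h - 3 • (Usym n g * TSOP n 1 (n / 6 + 1) g h))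

/-- The `n`-fold tensor product `|+⟩^{⊗n}`, with all amplitudes `(1/√2)^n`. -/
def plusState (n : ℕ) : QState n := fun _ => (((Real.sqrt 2)⁻¹ : ℝ) : ℂ) ^ n

/-- The controlled-`Z` gate between (1-based, cyclic) sites `j` and `k`. -/
def CZm (n : ℕ) [NeZero n] (j k : ℕ) : Op n :=
  Matrix.of fun s t =>
    if s = t then (if s (site n j) = 1 ∧ s (site n k) = 1 then -1 else 1) else 0

/-- The `n`-qubit cyclic cluster state `|C_n⟩ = (∏_{j=1}^n CZ_{j,j+1}) |+⟩^{⊗n}`. -/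
def cluster (n : ℕ) [NeZero n] : QState n :=
  (((List.range n).map (fun j => CZm n (j + 1) (j + 2))).prod).mulVec (plusState n)

section Trace

variable {ι : Type*} [Fintype ι] [DecidableEq ι]

open scoped MatrixOrder in
theorem trace_mul_nonneg_of_posSemidef {ρ O : Matrix ι ι ℂ} (hρ : ρ.PosSemidef)
    (hO : O.PosSemidef) : 0 ≤ (ρ * O).trace := by
  obtain ⟨M, rfl⟩ : ∃ M : Matrix ι ι ℂ, O = Mᴴ * M :=
    ⟨CFC.sqrt O, by
      rw [(CFC.sqrt_nonneg O).posSemidef.isHermitian.eq, CFC.sqrt_mul_sqrt_self O hO.nonneg]⟩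
  rw [← Matrix.mul_assoc, Matrix.trace_mul_comm, ← Matrix.mul_assoc]
  exact (hρ.mul_mul_conjTranspose_same M).trace_nonneg

/-- A positive semidefinite operator fixing a unit vector dominates the projection onto it. -/
theorem posSemidef_sub_vecMulVec {O : Matrix ι ι ℂ} (hO : O.PosSemidef) {v : ι → ℂ}
    (hv : star v ⬝ᵥ v = 1) (hOv : O.mulVec v = v) :
    (O - vecMulVec v (star v)).PosSemidef := by
  set P := vecMulVec v (star v) with hP
  have hPH : Pᴴ = P := by rw [hP, conjTranspose_vecMulVec, star_star]
  have hOP : O * P = P := by rw [hP, mul_vecMulVec, hOv]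
  have hPO : P * O = P := by
    have := congrArg conjTranspose hOP
    rwa [conjTranspose_mul, hPH, hO.isHermitian.eq] at this
  have hPP : P * P = P := by
    rw [hP, vecMulVec_mul_vecMulVec, hv, one_smul]
  have key : O - P = (1 - P)ᴴ * O * (1 - P) := by
    rw [conjTranspose_sub, conjTranspose_one, hPH]
    simp only [sub_mul, mul_sub, one_mul, mul_one, hPO, hOP, hPP]
    abel
  rw [key]
  exact hO.conjTranspose_mul_mul_same _

theorem re_dotProduct_le_re_trace {ρ O : Matrix ι ι ℂ} (hρ : ρ.PosSemidef)
    (hO : O.PosSemidef) {v : ι → ℂ} (hv : star v ⬝ᵥ v = 1) (hOv : O.mulVec v = v) :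
    (star v ⬝ᵥ ρ.mulVec v).re ≤ ((ρ * O).trace).re := by
  have h := trace_mul_nonneg_of_posSemidef hρ (posSemidef_sub_vecMulVec hO hv hOv)
  rw [mul_sub, trace_sub, mul_vecMulVec, trace_vecMulVec, dotProduct_comm] at h
  have := (Complex.le_def.mp h).1
  simpa using this

theorem posSemidef_combination {A B T : Matrix ι ι ℂ}
    (hA : Aᴴ = A) (hB : Bᴴ = B) (hT : Tᴴ = T)
    (hA2 : A * A = 1) (hB2 : B * B = 1) (hT2 : T * T = 1)
    (hAB : A * B = B * A) (hAT : A * T = T * A) :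
    ((32 : ℂ)⁻¹ • (12 • (1 : Matrix ι ι ℂ) + 12 • A + B + A * B
      - 3 • T - 3 • (A * T))).PosSemidef := by
  have key : (32 : ℂ)⁻¹ • (12 • (1 : Matrix ι ι ℂ) + 12 • A + B + A * B - 3 • T - 3 • (A * T))
      = (1 / 8 : ℂ) • ((1 + A)ᴴ * (1 + A))
        + (1 / 128 : ℂ) • (((1 + A) * (1 + B))ᴴ * ((1 + A) * (1 + B)))
        + (3 / 128 : ℂ) • (((1 + A) * (1 - T))ᴴ * ((1 + A) * (1 - T))) := by
    have e1 : (1 + A)ᴴ * (1 + A) = (2 : ℂ) • (1 + A) := by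
      simp only [conjTranspose_add, conjTranspose_one, hA, add_mul, mul_add, one_mul, mul_one, hA2]
      module
    have aux : ∀ C : Matrix ι ι ℂ, Cᴴ = C → C * C = 1 → A * C = C * A →
        ((1 + A) * (1 + C))ᴴ * ((1 + A) * (1 + C)) = (4 : ℂ) • ((1 + A) * (1 + C)) := by
      intro C hC hC2 hAC
      have hc : (1 + C) * (1 + A) = (1 + A) * (1 + C) := by
        simp only [add_mul, mul_add, one_mul, mul_one, hAC]; abel
      have e2 : (1 + A) * (1 + A) = (2 : ℂ) • (1 + A) := by
        simp only [add_mul, mul_add, one_mul, mul_one, hA2]; module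
      have e3 : (1 + C) * (1 + C) = (2 : ℂ) • (1 + C) := by
        simp only [add_mul, mul_add, one_mul, mul_one, hC2]; module
      rw [conjTranspose_mul, conjTranspose_add, conjTranspose_add, conjTranspose_one, hA, hC, hc,
        mul_assoc, ← mul_assoc (1 + C), hc, mul_assoc, e3, ← mul_assoc, e2, smul_mul_smul_comm]
      norm_num
    have e3 := aux (-T) (by rw [conjTranspose_neg, hT]) (by rw [neg_mul_neg, hT2])
      (by rw [mul_neg, neg_mul, hAT])
    rw [← sub_eq_add_neg] at e3
    rw [e1, aux B hB hB2 hAB, e3]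
    simp only [add_mul, mul_add, mul_sub, one_mul, mul_one]
    module
  rw [key]
  refine ((PosSemidef.smul (posSemidef_conjTranspose_mul_self _) ?_).add
    (PosSemidef.smul (posSemidef_conjTranspose_mul_self _) ?_)).add
    (PosSemidef.smul (posSemidef_conjTranspose_mul_self _) ?_)
  all_goals
    rw [Complex.le_def]
    norm_num

end Trace

section Pauli

variable {n : ℕ}

/-- Flip the `i`-th bit of a bit string. -/
def flipBit (i : Fin n) (s : Fin n → Fin 2) : Fin n → Fin 2 := Function.update s i (s i + 1)

/-- The sign `(-1)^b` of a bit. -/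
def bitSign (b : Fin 2) : ℂ := if b = 1 then -1 else 1

theorem bitSign_mul_self (b : Fin 2) : bitSign b * bitSign b = 1 := by
  fin_cases b <;> simp [bitSign]

theorem bitSign_add_one (b : Fin 2) : bitSign (b + 1) = -bitSign b := by
  fin_cases b <;> simp [bitSign]

theorem flipBit_flipBit (i : Fin n) (s : Fin n → Fin 2) : flipBit i (flipBit i s) = s := by
  have : ∀ b : Fin 2, b + 1 + 1 = b := by decide
  simp [flipBit, this]

theorem flipBit_comm (i j : Fin n) (s : Fin n → Fin 2) :
    flipBit i (flipBit j s) = flipBit j (flipBit i s) := by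
  by_cases h : i = j
  · rw [h]
  · simp only [flipBit, Function.update_of_ne h, Function.update_of_ne (Ne.symm h)]
    exact Function.update_comm (Ne.symm h) _ _ _

theorem onSite_Xmat_mulVec (i : Fin n) (ψ : QState n) (s : Fin n → Fin 2) :
    (onSite n i Xmat).mulVec ψ s = ψ (flipBit i s) := by
  rw [mulVec, dotProduct, Finset.sum_eq_single (flipBit i s)]
  · have h1 : ∀ k, k ≠ i → s k = flipBit i s k := fun k hk => by
      simp [flipBit, Function.update_of_ne hk]
    have h2 : ∀ b : Fin 2, Xmat b (b + 1) = 1 := by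
      intro b; fin_cases b <;> simp [Xmat]
    simp only [onSite, of_apply]
    rw [if_pos h1]
    simp [flipBit, h2]
  · intro t _ ht
    simp only [onSite, of_apply]
    split_ifs with h
    · have hti : s i = t i := by
        by_contra hne
        apply ht
        funext k
        by_cases hk : k = i
        · subst hk
          have : ∀ a b : Fin 2, a ≠ b → b = a + 1 := by decide
          simpa [flipBit] using this _ _ hne
        · simp [flipBit, Function.update_of_ne hk, h k hk]
      have h2 : ∀ b : Fin 2, Xmat b b = 0 := by
        intro b; fin_cases b <;> simp [Xmat]
      simp [hti, h2]
    · simp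
  · simp

theorem onSite_Zmat_eq (i : Fin n) :
    onSite n i Zmat = diagonal fun s => bitSign (s i) := by
  ext s t
  rw [diagonal_apply]
  have hd : ∀ b : Fin 2, Zmat b b = bitSign b := by
    intro b; fin_cases b <;> simp [Zmat, bitSign]
  have ho : ∀ a b : Fin 2, a ≠ b → Zmat a b = 0 := by
    intro a b hab; fin_cases a <;> fin_cases b <;> simp_all [Zmat]
  simp only [onSite, of_apply]
  split_ifs with h1 h2 h2
  · simp [h2, hd]
  · have : s i ≠ t i := fun h => h2 (funext fun k => by
      by_cases hk : k = i
      · rw [hk, h]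
      · exact h1 k hk)
    simp [ho _ _ this]
  · exact absurd (fun k _ => by rw [h2]) h1
  · simp

theorem onSite_Zmat_mulVec (i : Fin n) (ψ : QState n) (s : Fin n → Fin 2) :
    (onSite n i Zmat).mulVec ψ s = bitSign (s i) * ψ s := by
  rw [onSite_Zmat_eq, mulVec_diagonal]

theorem onSite_conjTranspose (i : Fin n) {M : Matrix (Fin 2) (Fin 2) ℂ} (hM : Mᴴ = M) :
    (onSite n i M)ᴴ = onSite n i M := by
  ext s t
  have h : star (M (t i) (s i)) = M (s i) (t i) := congrFun (congrFun hM (s i)) (t i)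
  have hc : (∀ k, k ≠ i → t k = s k) ↔ (∀ k, k ≠ i → s k = t k) :=
    ⟨fun h k hk => (h k hk).symm, fun h k hk => (h k hk).symm⟩
  simp only [onSite, conjTranspose_apply, of_apply, star_mul', h, hc]
  split_ifs <;> simp

theorem op_ext {M N : Op n} (h : ∀ ψ s, M.mulVec ψ s = N.mulVec ψ s) : M = N :=
  Matrix.ext_of_mulVec_single fun _ => funext fun s => h _ s

variable [NeZero n]

theorem PX_mulVec (j : ℕ) (ψ : QState n) (s : Fin n → Fin 2) :
    (PX n j).mulVec ψ s = ψ (flipBit (site n j) s) := onSite_Xmat_mulVec _ _ _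

theorem PZ_mulVec (j : ℕ) (ψ : QState n) (s : Fin n → Fin 2) :
    (PZ n j).mulVec ψ s = bitSign (s (site n j)) * ψ s := onSite_Zmat_mulVec _ _ _

theorem PX_conjTranspose (j : ℕ) : (PX n j)ᴴ = PX n j :=
  onSite_conjTranspose _ (by ext a b; fin_cases a <;> fin_cases b <;> simp [Xmat])

theorem PZ_conjTranspose (j : ℕ) : (PZ n j)ᴴ = PZ n j :=
  onSite_conjTranspose _ (by ext a b; fin_cases a <;> fin_cases b <;> simp [Zmat])

theorem PX_mul_self (j : ℕ) : PX n j * PX n j = 1 :=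
  op_ext fun ψ s => by
    simp only [← mulVec_mulVec, PX_mulVec, flipBit_flipBit, one_mulVec]

theorem PZ_mul_self (j : ℕ) : PZ n j * PZ n j = 1 :=
  op_ext fun ψ s => by
    simp only [← mulVec_mulVec, PZ_mulVec, ← mul_assoc, bitSign_mul_self, one_mulVec, one_mul]

theorem PX_commute (i j : ℕ) : Commute (PX n i) (PX n j) :=
  op_ext fun ψ s => by
    simp only [← mulVec_mulVec, PX_mulVec, flipBit_comm]

theorem PZ_commute (i j : ℕ) : Commute (PZ n i) (PZ n j) :=
  op_ext fun ψ s => by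
    simp only [← mulVec_mulVec, PZ_mulVec]
    ring

theorem PX_commute_PZ {i j : ℕ} (h : site n i ≠ site n j) : Commute (PX n i) (PZ n j) :=
  op_ext fun ψ s => by
    simp only [← mulVec_mulVec, PX_mulVec, PZ_mulVec, flipBit, Function.update_of_ne h.symm]

theorem PX_semiconjBy_PZ {i j : ℕ} (h : site n i = site n j) :
    SemiconjBy (PX n i) (PZ n j) (-PZ n j) :=
  op_ext fun ψ s => by
    simp only [← mulVec_mulVec, neg_mul, neg_mulVec, Pi.neg_apply, PX_mulVec, PZ_mulVec, flipBit,
      h, Function.update_self, bitSign_add_one]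

/-- The monoid generated by the real Pauli operators. -/
def pauliMonoid (n : ℕ) [NeZero n] : Submonoid (Op n) :=
  Submonoid.closure (Set.range (PX n) ∪ Set.range (PZ n))

theorem PX_mem (j : ℕ) : PX n j ∈ pauliMonoid n :=
  Submonoid.subset_closure (Or.inl ⟨j, rfl⟩)

theorem PZ_mem (j : ℕ) : PZ n j ∈ pauliMonoid n :=
  Submonoid.subset_closure (Or.inr ⟨j, rfl⟩)

theorem PX_PZ_comm_or (i j : ℕ) :
    PX n i * PZ n j = PZ n j * PX n i ∨ PX n i * PZ n j = -(PZ n j * PX n i) := by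
  by_cases h : site n i = site n j
  · right; rw [← neg_mul]; exact PX_semiconjBy_PZ h
  · left; exact PX_commute_PZ h

theorem mul_comm_or_neg {R : Type*} [Ring R] {a b c : R}
    (hb : a * b = b * a ∨ a * b = -(b * a)) (hc : a * c = c * a ∨ a * c = -(c * a)) :
    a * (b * c) = b * c * a ∨ a * (b * c) = -(b * c * a) := by
  rw [← mul_assoc]
  rcases hb with hb | hb <;> rcases hc with hc | hc <;> simp [hb, hc, mul_assoc]

theorem pauli_comm_or {M N : Op n} (hM : M ∈ pauliMonoid n) (hN : N ∈ pauliMonoid n) :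
    M * N = N * M ∨ M * N = -(N * M) := by
  have flip : ∀ {a b : Op n}, (a * b = b * a ∨ a * b = -(b * a)) →
      (b * a = a * b ∨ b * a = -(a * b)) := by
    rintro a b (h | h)
    · exact Or.inl h.symm
    · right; rw [h, neg_neg]
  induction hN using Submonoid.closure_induction with
  | one => left; simp
  | mul x y _ _ hx hy => exact mul_comm_or_neg hx hy
  | mem N hN =>
    apply flip
    induction hM using Submonoid.closure_induction with
    | one => left; simp
    | mul x y _ _ hx hy => exact mul_comm_or_neg hx hy
    | mem M hM =>
      rcases hN with ⟨i, rfl⟩ | ⟨i, rfl⟩ <;> rcases hM with ⟨j, rfl⟩ | ⟨j, rfl⟩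
      · exact Or.inl (PX_commute i j)
      · exact PX_PZ_comm_or i j
      · exact flip (PX_PZ_comm_or j i)
      · exact Or.inl (PZ_commute i j)

theorem pauli_conjTranspose_mul_self {M : Op n} (hM : M ∈ pauliMonoid n) : Mᴴ * M = 1 := by
  induction hM using Submonoid.closure_induction with
  | one => simp
  | mem M hM =>
    rcases hM with ⟨i, rfl⟩ | ⟨i, rfl⟩
    · rw [PX_conjTranspose, PX_mul_self]
    · rw [PZ_conjTranspose, PZ_mul_self]
  | mul x y _ _ hx hy => rw [conjTranspose_mul, mul_assoc, ← mul_assoc xᴴ, hx, one_mul, hy]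

theorem pauli_mul_self_or {M : Op n} (hM : M ∈ pauliMonoid n) : M * M = 1 ∨ M * M = -1 := by
  induction hM using Submonoid.closure_induction with
  | one => simp
  | mem M hM =>
    rcases hM with ⟨i, rfl⟩ | ⟨i, rfl⟩
    · exact Or.inl (PX_mul_self i)
    · exact Or.inl (PZ_mul_self i)
  | mul x y hx hy ihx ihy =>
    have e : x * y * (x * y) = x * (y * x) * y := by simp only [mul_assoc]
    have e' : x * (x * y) * y = (x * x) * (y * y) := by simp only [mul_assoc]
    rcases pauli_comm_or hy hx with h | h <;> rw [e, h] <;>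
      simp only [mul_neg, neg_mul, e'] <;>
      rcases ihx with ihx | ihx <;> rcases ihy with ihy | ihy <;> simp [ihx, ihy]

/-- Pauli operators sharing an eigenvector with nonzero eigenvalues commute. -/
theorem pauli_commute_of_eigenvector {M N : Op n} (hM : M ∈ pauliMonoid n)
    (hN : N ∈ pauliMonoid n) {v : QState n} (hv : v ≠ 0) {a b : ℂ} (ha : a ≠ 0) (hb : b ≠ 0)
    (hMv : M.mulVec v = a • v) (hNv : N.mulVec v = b • v) : M * N = N * M := by
  refine (pauli_comm_or hM hN).resolve_right fun h => ?_
  have h1 := congrArg (fun K : Op n => K.mulVec v) h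
  simp only [neg_mulVec, ← mulVec_mulVec, hMv, hNv, mulVec_smul, smul_smul] at h1
  rw [mul_comm a b, eq_neg_iff_add_eq_zero, ← add_smul, smul_eq_zero] at h1
  rcases h1 with h1 | h1
  · rw [← two_mul] at h1
    simp [ha, hb] at h1
  · exact hv h1

theorem pauli_mul_self_of_eigenvector {M : Op n} (hM : M ∈ pauliMonoid n) {v : QState n}
    (hv : v ≠ 0) {a : ℂ} (ha : a * a = 1) (hMv : M.mulVec v = a • v) : M * M = 1 := by
  refine (pauli_mul_self_or hM).resolve_right fun h => ?_
  have h1 := congrArg (fun K : Op n => K.mulVec v) h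
  simp only [neg_mulVec, one_mulVec, ← mulVec_mulVec, hMv, mulVec_smul, smul_smul, ha,
    one_smul] at h1
  rw [eq_neg_iff_add_eq_zero, ← two_smul ℂ, smul_eq_zero] at h1
  exact h1.elim (by norm_num) hv

theorem pauli_isHermitian_of_mul_self {M : Op n} (hM : M ∈ pauliMonoid n) (h : M * M = 1) :
    Mᴴ = M := by
  rw [← mul_one Mᴴ, ← h, ← mul_assoc, pauli_conjTranspose_mul_self hM, one_mul]

end Pauli

section Sites

variable {n : ℕ} [NeZero n]

theorem site_eq_iff {i j : ℕ} : site n i = site n j ↔ i ≡ j [MOD n] := by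
  rw [site, site, Fin.mk.injEq]
  exact ⟨fun h => Nat.ModEq.add_right_cancel' (n - 1) h, fun h => h.add_right _⟩

theorem site_add_self (j : ℕ) : site n (j + n) = site n j :=
  site_eq_iff.mpr (by simp [Nat.ModEq])

theorem site_ne_of_lt {i j : ℕ} (h : i < j) (hj : j < i + n) : site n i ≠ site n j := by
  rw [Ne, site_eq_iff, Nat.modEq_iff_dvd' h.le]
  exact fun hd => absurd (Nat.le_of_dvd (by omega) hd) (by omega)

theorem site_ne_of_parity (hn : 2 ∣ n) {i j : ℕ} (h : i % 2 ≠ j % 2) : site n i ≠ site n j :=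
  fun he => h ((site_eq_iff.mp he).of_dvd hn)

theorem site_add_one (j : ℕ) : site n (j + 1) = site n j + 1 := by
  apply Fin.ext
  rw [Fin.val_add, Fin.val_one']
  simp only [site, ← Nat.add_mod]
  congr 1
  omega

theorem site_val_add_one (i : Fin n) : site n (i + 1) = i := by
  apply Fin.ext
  have h := i.isLt
  simp only [site]
  rw [show (i : ℕ) + 1 + (n - 1) = i + n by omega, Nat.add_mod_right, Nat.mod_eq_of_lt h]

end Sites

section Cluster

variable {n : ℕ}

/-- The phase of the controlled-`Z` gate on a pair of bits. -/
def czSign (a b : Fin 2) : ℂ := if a = 1 ∧ b = 1 then -1 else 1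

theorem czSign_add_one_left (a b : Fin 2) : czSign (a + 1) b = czSign a b * bitSign b := by
  fin_cases a <;> fin_cases b <;> simp [czSign, bitSign]

theorem czSign_add_one_right (a b : Fin 2) : czSign a (b + 1) = czSign a b * bitSign a := by
  fin_cases a <;> fin_cases b <;> simp [czSign, bitSign]

theorem list_prod_map_diagonal {ι : Type*} [Fintype ι] [DecidableEq ι] (d : ℕ → ι → ℂ) (m : ℕ) :
    ((List.range m).map fun j => diagonal (d j)).prod
      = diagonal fun s => ∏ j ∈ Finset.range m, d j s := by
  induction m with
  | zero => simp
  | succ m ih => simp [List.range_succ, ih, Finset.prod_range_succ]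

variable [NeZero n]

theorem CZm_eq_diagonal (j k : ℕ) :
    CZm n j k = diagonal fun s => czSign (s (site n j)) (s (site n k)) := by
  ext s t
  rw [diagonal_apply]
  rfl

theorem cluster_apply (s : Fin n → Fin 2) :
    cluster n s
      = (∏ i : Fin n, czSign (s i) (s (i + 1))) * (((Real.sqrt 2)⁻¹ : ℝ) : ℂ) ^ n := by
  simp only [cluster, CZm_eq_diagonal]
  have hprod := list_prod_map_diagonal (fun j (s : Fin n → Fin 2) =>
    czSign (s (site n (j + 1))) (s (site n (j + 2)))) n
  rw [hprod, mulVec_diagonal, plusState, Finset.prod_range]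
  congr 1
  refine Finset.prod_congr rfl fun i _ => ?_
  rw [show (i : ℕ) + 2 = i + 1 + 1 from rfl, site_add_one (i + 1), site_val_add_one]

theorem star_cluster_dotProduct_self : star (cluster n) ⬝ᵥ cluster n = 1 := by
  have hsq : ∀ s : Fin n → Fin 2, star (cluster n s) * cluster n s = ((2 : ℂ)⁻¹) ^ n := by
    intro s
    have hcz : ∀ a b : Fin 2, star (czSign a b) * czSign a b = 1 := by
      intro a b; fin_cases a <;> fin_cases b <;> simp [czSign]
    have hs : star (((Real.sqrt 2)⁻¹ : ℝ) : ℂ) * (((Real.sqrt 2)⁻¹ : ℝ) : ℂ) = (2 : ℂ)⁻¹ := by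
      rw [Complex.star_def, Complex.conj_ofReal, ← Complex.ofReal_mul, ← mul_inv,
        Real.mul_self_sqrt (by norm_num)]
      norm_num
    rw [cluster_apply, star_mul', star_prod, star_pow, mul_mul_mul_comm, ← mul_pow, hs,
      ← Finset.prod_mul_distrib, Finset.prod_congr rfl fun i _ => hcz _ _]
    simp
  simp only [dotProduct, Pi.star_apply, hsq]
  simp

theorem cluster_ne_zero : cluster n ≠ 0 := fun h => by
  have := star_cluster_dotProduct_self (n := n)
  simp [h] at this

theorem cluster_flipBit (hn : 2 ≤ n) (p : Fin n) (s : Fin n → Fin 2) :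
    cluster n (flipBit (p + 1) s) = bitSign (s p) * (bitSign (s (p + 1 + 1)) * cluster n s) := by
  have hne : ∀ i : Fin n, i ≠ i + 1 := by
    intro i h
    have h1 := congrArg Fin.val (left_eq_add.mp h)
    rw [Fin.val_one', Nat.mod_eq_of_lt (by omega)] at h1
    exact one_ne_zero h1
  have hfac : ∀ i : Fin n, czSign (flipBit (p + 1) s i) (flipBit (p + 1) s (i + 1))
      = czSign (s i) (s (i + 1)) * ((if i = p then bitSign (s p) else 1)
        * (if i = p + 1 then bitSign (s (p + 1 + 1)) else 1)) := by
    intro i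
    by_cases h1 : i = p
    · subst h1
      simp [flipBit, hne i, czSign_add_one_right]
    · by_cases h2 : i = p + 1
      · subst h2
        simp [flipBit, Function.update_of_ne (hne (p + 1)).symm, czSign_add_one_left, h1]
      · have h3 : i + 1 ≠ p + 1 := fun h => h1 (add_right_cancel h)
        rw [flipBit, Function.update_of_ne h2, Function.update_of_ne h3]
        simp [h1, h2]
  rw [cluster_apply, cluster_apply, Finset.prod_congr rfl fun i _ => hfac i,
    Finset.prod_mul_distrib, Finset.prod_mul_distrib, Finset.prod_ite_eq', Finset.prod_ite_eq']
  simp only [Finset.mem_univ, if_true]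
  ring

/-- The cluster stabilizer relation `X_{j+1} |C_n⟩ = Z_j Z_{j+2} |C_n⟩`. -/
theorem PX_mulVec_cluster (hn : 2 ≤ n) (j : ℕ) :
    (PX n (j + 1)).mulVec (cluster n) = (PZ n j * PZ n (j + 2)).mulVec (cluster n) := by
  funext s
  rw [← mulVec_mulVec, PX_mulVec, PZ_mulVec, PZ_mulVec, site_add_one, cluster_flipBit hn,
    show j + 2 = j + 1 + 1 from rfl, site_add_one (j + 1), site_add_one]

end Cluster

section Rows

variable {n : ℕ}

theorem pow_val_mul_pow_val {M : Op n} (h : M * M = 1) (a b : ZMod 2) :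
    M ^ a.val * M ^ b.val = M ^ (a + b).val := by
  rw [← pow_add, ZMod.val_add, pow_eq_pow_mod _ (by rw [pow_two, h] : M ^ 2 = 1)]

theorem pow_mulVec_eq_self {M : Op n} {v : QState n} (h : M.mulVec v = v) (k : ℕ) :
    (M ^ k).mulVec v = v := by
  induction k with
  | zero => simp
  | succ k ih => rw [pow_succ, ← mulVec_mulVec, h, ih]

variable [NeZero n]

/-- The product `X_{j+1} X_{j+3} ⋯ X_{j+2m-1}` over every other site. -/
def xRow (n : ℕ) [NeZero n] (j m : ℕ) : Op n :=
  ((List.range m).map fun i => PX n (j + 1 + 2 * i)).prod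

@[simp]
theorem xRow_zero (j : ℕ) : xRow n j 0 = 1 := by simp [xRow]

theorem xRow_succ (j m : ℕ) : xRow n j (m + 1) = xRow n j m * PX n (j + 1 + 2 * m) := by
  simp [xRow, List.range_succ]

theorem xRow_succ' (j m : ℕ) : xRow n j (m + 1) = PX n (j + 1) * xRow n (j + 2) m := by
  rw [xRow, List.range_succ_eq_map, List.map_cons, List.prod_cons, List.map_map, xRow]
  have h : (fun i => PX n (j + 1 + 2 * i)) ∘ Nat.succ = fun i => PX n (j + 2 + 1 + 2 * i) := by
    funext i
    exact congrArg (PX n) (by simp only [Nat.succ_eq_add_one]; omega)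
  rw [h]

theorem xRow_mem (j m : ℕ) : xRow n j m ∈ pauliMonoid n := by
  induction m with
  | zero => rw [xRow_zero]; exact one_mem _
  | succ m ih => rw [xRow_succ]; exact mul_mem ih (PX_mem _)

theorem xRow_commute_PX (j m k : ℕ) : Commute (xRow n j m) (PX n k) := by
  induction m with
  | zero => rw [xRow_zero]; exact Commute.one_left _
  | succ m ih => rw [xRow_succ]; exact ih.mul_left (PX_commute _ _)

theorem xRow_commute (j m k l : ℕ) : Commute (xRow n j m) (xRow n k l) := by
  induction l with
  | zero => rw [xRow_zero]; exact Commute.one_right _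
  | succ l ih => rw [xRow_succ]; exact ih.mul_right (xRow_commute_PX _ _ _)

theorem xRow_mul_self (j m : ℕ) : xRow n j m * xRow n j m = 1 := by
  induction m with
  | zero => simp
  | succ m ih =>
    rw [xRow_succ, (xRow_commute_PX j m _).symm.mul_mul_mul_comm, ih, PX_mul_self, one_mul]

theorem xRow_commute_PZ {j m k : ℕ} (h : ∀ i < m, site n (j + 1 + 2 * i) ≠ site n k) :
    Commute (xRow n j m) (PZ n k) := by
  induction m with
  | zero => rw [xRow_zero]; exact Commute.one_left _
  | succ m ih =>
    rw [xRow_succ]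
    exact (ih fun i hi => h i (by omega)).mul_left (PX_commute_PZ (h m (by omega)))

theorem xRow_semiconjBy_PZ {j m i : ℕ} (hi : i < m) (hm : 2 * m ≤ n) :
    SemiconjBy (xRow n j m) (PZ n (j + 1 + 2 * i)) (-PZ n (j + 1 + 2 * i)) := by
  induction m with
  | zero => omega
  | succ m ih =>
    rw [xRow_succ]
    rcases (Nat.lt_succ_iff_lt_or_eq.mp hi) with h | rfl
    · exact (ih h (by omega)).mul_left
        (PX_commute_PZ (site_ne_of_lt (by omega) (by omega)).symm)
    · exact SemiconjBy.mul_left (Commute.neg_right (xRow_commute_PZ fun k hk =>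
        site_ne_of_lt (by omega) (by omega))) (PX_semiconjBy_PZ rfl)

theorem xRow_mulVec_cluster (hn2 : 2 ≤ n) (hn : 2 ∣ n) (j m : ℕ) :
    (xRow n j m).mulVec (cluster n) = (PZ n j * PZ n (j + 2 * m)).mulVec (cluster n) := by
  induction m with
  | zero => simp [PZ_mul_self]
  | succ m ih =>
    have hc : ∀ k, k % 2 = j % 2 → Commute (xRow n j m) (PZ n k) := fun k hk =>
      xRow_commute_PZ fun i _ => site_ne_of_parity hn (by omega)
    rw [xRow_succ, ← mulVec_mulVec, show j + 1 + 2 * m = j + 2 * m + 1 by omega,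
      PX_mulVec_cluster hn2, mulVec_mulVec,
      ((hc (j + 2 * m) (by omega)).mul_right (hc (j + 2 * m + 2) (by omega))).eq,
      ← mulVec_mulVec, ih, mulVec_mulVec, (PZ_commute j (j + 2 * m)).eq,
      (PZ_commute (j + 2 * m) (j + 2 * m + 2)).eq, mul_assoc, ← mul_assoc (PZ n (j + 2 * m)),
      PZ_mul_self, one_mul, (PZ_commute _ j).eq]
    rfl

theorem list_prod_map_PX_pow (j k m a b : ℕ) :
    ((List.range m).map
      fun i => PX n (j + 1 + 2 * i) ^ a * PX n (k + 1 + 2 * i) ^ b).prod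
      = xRow n j m ^ a * xRow n k m ^ b := by
  induction m with
  | zero => simp
  | succ m ih =>
    rw [List.range_succ, List.map_append, List.prod_append, ih, xRow_succ, xRow_succ,
      (xRow_commute_PX j m _).mul_pow, (xRow_commute_PX k m _).mul_pow]
    simp only [List.map_cons, List.map_nil, List.prod_cons, List.prod_nil, mul_one]
    rw [((xRow_commute_PX k m (j + 1 + 2 * m)).pow_pow b a).mul_mul_mul_comm]

theorem Usym_eq (g : G2) :
    Usym n g = xRow n 0 (n / 2) ^ g.1.val * xRow n 1 (n / 2) ^ g.2.val := by
  rw [← list_prod_map_PX_pow, Usym]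
  congr 3
  funext p
  rw [show 0 + 1 + 2 * p = 2 * p + 1 by omega, show 1 + 1 + 2 * p = 2 * p + 2 by omega]

theorem Ustr_eq (m : ℕ) (g : G2) :
    Ustr n 1 (m + 2) g = xRow n 2 m ^ g.1.val * xRow n 3 m ^ g.2.val := by
  rw [← list_prod_map_PX_pow, Ustr, show m + 2 - (1 + 1) = m by omega]
  congr 3
  funext p
  rw [show 2 * (1 + 1 + p) - 1 = 2 + 1 + 2 * p by omega,
    show 2 * (1 + 1 + p) = 3 + 1 + 2 * p by omega]

theorem Usym_mem (g : G2) : Usym n g ∈ pauliMonoid n := by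
  rw [Usym_eq]
  exact mul_mem (pow_mem (xRow_mem _ _) _) (pow_mem (xRow_mem _ _) _)

theorem Usym_mul (g h : G2) : Usym n g * Usym n h = Usym n (g + h) := by
  rw [Usym_eq, Usym_eq, Usym_eq, ((xRow_commute 1 _ 0 _).pow_pow _ _).mul_mul_mul_comm,
    pow_val_mul_pow_val (xRow_mul_self _ _), pow_val_mul_pow_val (xRow_mul_self _ _)]
  rfl

theorem xRow_half_mulVec_cluster (hn2 : 2 ≤ n) (hn : 2 ∣ n) (j : ℕ) :
    (xRow n j (n / 2)).mulVec (cluster n) = cluster n := by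
  have hs : PZ n (j + n) = PZ n j := by rw [PZ, PZ, site_add_self]
  rw [xRow_mulVec_cluster hn2 hn, Nat.mul_div_cancel' hn, hs, PZ_mul_self, one_mulVec]

theorem Usym_mulVec_cluster (hn2 : 2 ≤ n) (hn : 2 ∣ n) (g : G2) :
    (Usym n g).mulVec (cluster n) = cluster n := by
  rw [Usym_eq, ← mulVec_mulVec, pow_mulVec_eq_self (xRow_half_mulVec_cluster hn2 hn 1),
    pow_mulVec_eq_self (xRow_half_mulVec_cluster hn2 hn 0)]

end Rows

section StringOrder

variable {n : ℕ} [NeZero n]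

theorem zmod_two_eq_zero_or_one (a : ZMod 2) : a = 0 ∨ a = 1 := by
  revert a; decide

theorem VL_one_eq (g : G2) :
    VL n 1 g = PZ n 1 ^ g.2.val * (PX n 2 ^ g.2.val * PZ n 2 ^ g.1.val) := rfl

theorem VR_add_two_eq (m : ℕ) (g : G2) :
    VR n (m + 2) g = PZ n (2 * m + 3) ^ g.2.val * PX n (2 * m + 3) ^ g.1.val
      * PZ n (2 * m + 4) ^ g.1.val := by
  rw [VR, show 2 * (m + 2) - 1 = 2 * m + 3 by omega, show 2 * (m + 2) = 2 * m + 4 by omega]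

theorem evenString_mulVec_cluster (hn2 : 2 ≤ n) (hn : 2 ∣ n) (m : ℕ) :
    (PZ n (2 * m + 3) * PZ n 1 * (PX n 2 * xRow n 3 m)).mulVec (cluster n) = cluster n := by
  have h := xRow_succ' (n := n) 1 m
  norm_num at h
  rw [← h, ← mulVec_mulVec, xRow_mulVec_cluster hn2 hn, show 1 + 2 * (m + 1) = 2 * m + 3 by omega,
    mulVec_mulVec, mul_assoc, ← mul_assoc (PZ n 1), PZ_mul_self, one_mul, PZ_mul_self, one_mulVec]

theorem oddString_mulVec_cluster (hn2 : 2 ≤ n) (hn : 2 ∣ n) (m : ℕ) :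
    (PX n (2 * m + 3) * PZ n (2 * m + 4) * PZ n 2 * xRow n 2 m).mulVec (cluster n)
      = cluster n := by
  have h : PX n (2 * m + 3) * PZ n (2 * m + 4) * PZ n 2 * xRow n 2 m
      = PZ n (2 * m + 4) * PZ n 2 * xRow n 2 (m + 1) := by
    rw [xRow_succ, (xRow_commute_PX _ _ _).eq, show 2 + 1 + 2 * m = 2 * m + 3 by omega,
      mul_assoc (PX n (2 * m + 3)), Commute.eq (Commute.mul_right
        (PX_commute_PZ (site_ne_of_parity hn (by omega)))
        (PX_commute_PZ (site_ne_of_parity hn (by omega))))]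
    simp only [mul_assoc]
  rw [h, ← mulVec_mulVec, xRow_mulVec_cluster hn2 hn, show 2 + 2 * (m + 1) = 2 * m + 4 by omega,
    mulVec_mulVec, mul_assoc, ← mul_assoc (PZ n 2), PZ_mul_self, one_mul, PZ_mul_self, one_mulVec]

theorem string_mulVec_cluster (hn : 2 ∣ n) {m : ℕ} (hm : 2 * m + 4 ≤ n) (g : G2) :
    (VR n (m + 2) g * VL n 1 g * Ustr n 1 (m + 2) g).mulVec (cluster n) = cluster n := by
  have hn2 : 2 ≤ n := by omega
  have hx := evenString_mulVec_cluster hn2 hn m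
  have hy := oddString_mulVec_cluster hn2 hn m
  rw [VR_add_two_eq, VL_one_eq, Ustr_eq]
  obtain ⟨a, b⟩ := g
  rcases zmod_two_eq_zero_or_one a with rfl | rfl <;>
    rcases zmod_two_eq_zero_or_one b with rfl | rfl
  · simp
  · simpa [ZMod.val_one, mul_assoc] using hx
  · simpa [ZMod.val_one, mul_assoc] using hy
  · have e : PZ n (2 * m + 3) * PX n (2 * m + 3) * PZ n (2 * m + 4)
          * (PZ n 1 * (PX n 2 * PZ n 2)) * (xRow n 2 m * xRow n 3 m)
        = PZ n (2 * m + 3) * PZ n 1 * (PX n 2 * xRow n 3 m)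
          * (PX n (2 * m + 3) * PZ n (2 * m + 4) * PZ n 2 * xRow n 2 m) := by
      have c1 : Commute (PX n (2 * m + 3) * PZ n (2 * m + 4)) (PZ n 1 * PX n 2) :=
        ((PX_commute_PZ (site_ne_of_lt (by omega) (by omega)).symm).mul_right
          (PX_commute _ _)).mul_left
        ((PZ_commute _ _).mul_right
          (PX_commute_PZ (site_ne_of_lt (by omega) (by omega))).symm)
      have c2 : Commute (xRow n 3 m)
          (PX n (2 * m + 3) * PZ n (2 * m + 4) * PZ n 2 * xRow n 2 m) :=
        (((xRow_commute_PX _ _ _).mul_right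
          (xRow_commute_PZ fun i _ => site_ne_of_lt (by omega) (by omega))).mul_right
          (xRow_commute_PZ fun i _ => (site_ne_of_lt (by omega) (by omega)).symm)).mul_right
          (xRow_commute _ _ _ _)
      rw [mul_assoc _ (PX n 2 * xRow n 3 m), mul_assoc (PX n 2), c2.eq]
      calc _ = PZ n (2 * m + 3) * ((PX n (2 * m + 3) * PZ n (2 * m + 4)) * (PZ n 1 * PX n 2))
            * PZ n 2 * (xRow n 2 m * xRow n 3 m) := by simp only [mul_assoc]
        _ = _ := by rw [c1.eq]; simp only [mul_assoc]
    simp only [ZMod.val_one, pow_one]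
    rw [e, ← mulVec_mulVec, hy, hx]

theorem VR_mul_Usym (hn : 2 ∣ n) {m : ℕ} (hm : 2 * m + 4 ≤ n) {g h : G2} (hg : g ≠ 0)
    (hh : h ≠ 0) (hgh : g ≠ h) :
    VR n (m + 2) g * Usym n h = -(Usym n h * VR n (m + 2) g) := by
  have p1 : SemiconjBy (xRow n 0 (n / 2)) (PZ n (2 * m + 3)) (-PZ n (2 * m + 3)) := by
    have := xRow_semiconjBy_PZ (n := n) (j := 0) (m := n / 2) (i := m + 1) (by omega) (by omega)
    rwa [show 0 + 1 + 2 * (m + 1) = 2 * m + 3 by omega] at this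
  have p2 : Commute (xRow n 0 (n / 2)) (PZ n (2 * m + 4)) :=
    xRow_commute_PZ fun i _ => site_ne_of_parity hn (by omega)
  have p3 : Commute (xRow n 0 (n / 2)) (PX n (2 * m + 3)) := xRow_commute_PX _ _ _
  have q1 : Commute (xRow n 1 (n / 2)) (PZ n (2 * m + 3)) :=
    xRow_commute_PZ fun i _ => site_ne_of_parity hn (by omega)
  have q2 : SemiconjBy (xRow n 1 (n / 2)) (PZ n (2 * m + 4)) (-PZ n (2 * m + 4)) := by
    have := xRow_semiconjBy_PZ (n := n) (j := 1) (m := n / 2) (i := m + 1) (by omega) (by omega)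
    rwa [show 1 + 1 + 2 * (m + 1) = 2 * m + 4 by omega] at this
  have q3 : Commute (xRow n 1 (n / 2)) (PX n (2 * m + 3)) := xRow_commute_PX _ _ _
  suffices hs : SemiconjBy (Usym n h) (VR n (m + 2) g) (-VR n (m + 2) g) by
    rw [hs.eq, neg_mul, neg_neg]
  have hP := ((p1.pow_right g.2.val).mul_right (p3.pow_right g.1.val)).mul_right
    (p2.pow_right g.1.val)
  have hQ := (SemiconjBy.mul_right (q1.pow_right g.2.val) (q3.pow_right g.1.val)).mul_right
    (q2.pow_right g.1.val)
  rw [Usym_eq, VR_add_two_eq]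
  obtain ⟨a, b⟩ := g
  obtain ⟨c, d⟩ := h
  rcases zmod_two_eq_zero_or_one a with rfl | rfl <;>
    rcases zmod_two_eq_zero_or_one b with rfl | rfl <;>
    rcases zmod_two_eq_zero_or_one c with rfl | rfl <;>
    rcases zmod_two_eq_zero_or_one d with rfl | rfl <;>
    first
    | exact absurd rfl hg
    | exact absurd rfl hh
    | exact absurd rfl hgh
    | skip
  all_goals
    simp only [ZMod.val_one, ZMod.val_zero, pow_zero, pow_one, one_mul, mul_one, neg_mul,
      mul_neg] at hP hQ ⊢
    first
    | exact hP
    | exact hQ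
    | exact hP.mul_left hQ
    | exact hP.neg_right.mul_left hQ

theorem TSOP_mulVec_cluster (hn : 2 ∣ n) {m : ℕ} (hm : 2 * m + 4 ≤ n) {g h : G2} (hg : g ≠ 0)
    (hh : h ≠ 0) (hgh : g ≠ h) :
    (TSOP n 1 (m + 2) g h).mulVec (cluster n) = (-1 : ℂ) • cluster n := by
  rw [TSOP, VR_mul_Usym hn hm hg hh hgh, neg_mul, neg_mul, neg_mulVec, mul_assoc, mul_assoc,
    ← mul_assoc (VR n (m + 2) g), ← mulVec_mulVec, string_mulVec_cluster hn hm,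
    Usym_mulVec_cluster (by omega) hn, neg_one_smul]

theorem TSOP_mem (m : ℕ) (g h : G2) : TSOP n 1 (m + 2) g h ∈ pauliMonoid n := by
  have hX := fun j k => pow_mem (PX_mem (n := n) j) k
  have hZ := fun j k => pow_mem (PZ_mem (n := n) j) k
  rw [TSOP, VR_add_two_eq, VL_one_eq, Ustr_eq]
  exact mul_mem (mul_mem (mul_mem (mul_mem (mul_mem (hZ _ _) (hX _ _)) (hZ _ _)) (Usym_mem h))
    (mul_mem (hZ _ _) (mul_mem (hX _ _) (hZ _ _))))
    (mul_mem (pow_mem (xRow_mem _ _) _) (pow_mem (xRow_mem _ _) _))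

end StringOrder

/-- Corollary 2: the global fidelity with the cyclic cluster state lower-bounds the
triangle-game winning probability: `⟨C_n|ρ|C_n⟩ ≤ P_n^{(Q)}(g,h|ρ)` for all distinct
nontrivial `g, h`; in particular `f_n ≤ P_n^{(Q,min)}(ρ)`. -/
theorem fidelity_lower_bounds_winning_probability (n : ℕ) [NeZero n]
    (hn4 : 4 ≤ n) (hn : 6 ∣ n)
    (ρ : Op n) (hρ : ρ.PosSemidef) (htr : ρ.trace = 1)
    (g h : G2) (hg : g ≠ 0) (hh : h ≠ 0) (hgh : g ≠ h) :
    (star (cluster n) ⬝ᵥ ρ.mulVec (cluster n)).re ≤ ((ρ * Owin n g h).trace).re := by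
  obtain ⟨m, hm⟩ : ∃ m, n / 6 = m + 1 := ⟨n / 6 - 1, by omega⟩
  have hn2 : 2 ∣ n := by omega
  have hmn : 2 * m + 4 ≤ n := by omega
  have hv := cluster_ne_zero (n := n)
  have hU : ∀ k : G2, (Usym n k).mulVec (cluster n) = (1 : ℂ) • cluster n := fun k => by
    rw [one_smul, Usym_mulVec_cluster (by omega) hn2]
  have hT := TSOP_mulVec_cluster hn2 hmn hg hh hgh
  have hTmem := TSOP_mem (n := n) m g h
  have hU2 : ∀ k : G2, Usym n k * Usym n k = 1 := fun k =>
    pauli_mul_self_of_eigenvector (Usym_mem k) hv (by norm_num) (hU k)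
  have hT2 := pauli_mul_self_of_eigenvector hTmem hv (by norm_num) hT
  have hUT := pauli_commute_of_eigenvector (Usym_mem g) hTmem hv one_ne_zero (by norm_num)
    (hU g) hT
  have hO : Owin n g h = (32 : ℂ)⁻¹ • (12 • (1 : Op n) + 12 • Usym n g + Usym n h
      + Usym n g * Usym n h - 3 • TSOP n 1 (m + 2) g h
      - 3 • (Usym n g * TSOP n 1 (m + 2) g h)) := by
    rw [Owin, hm, Usym_mul]
  rw [hO]
  refine re_dotProduct_le_re_trace hρ
    (posSemidef_combination (pauli_isHermitian_of_mul_self (Usym_mem g) (hU2 g))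
      (pauli_isHermitian_of_mul_self (Usym_mem h) (hU2 h))
      (pauli_isHermitian_of_mul_self hTmem hT2) (hU2 g) (hU2 h) hT2
      (by rw [Usym_mul, Usym_mul, add_comm]) hUT)
    star_cluster_dotProduct_self ?_
  simp only [smul_mulVec, sub_mulVec, add_mulVec, one_mulVec, ← mulVec_mulVec, hU, hT,
    mulVec_smul, one_smul]
  module
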